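/- arXiv:1706.10195 — 2 statements merged into one kernel-verified Lean document; each statement's English description precedes it below -/
import Mathlib

section
/- Let q ∈ ℝ² have weight w_q > 0 and let P be a nonempty finite set of weighted points, each with positive weight, such that every p ∈ P strictly dominates q (q_x < p_x and q_y < p_y), p_x − p_y ≠ q_x − q_y for all p ∈ P, and all points of P ∪ {q} have pairwise distinct x-coordinates and pairwise distinct y-coordinates. Let D⁻(q) = {p ∈ P : p_x − p_y < q_x − q_y}. For p ∈ P let t_p = 2·max(p_x − q_x, p_y − q_y)/(w_p + w_q) be the first time □_p intersects □_q, and let t* = min_{p ∈ P} t_p. Then for any p ∈ P with t_p = t*: p ∈ D⁻(q) if and only if (r_q(t*))_y = (ℓ_p(t*))_y and (ℓ_p(t*))_y ≤ (ℓ_{p'}(t*))_y for all p' ∈ D⁻(q). -/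
/-- The bottom-left corner `ℓ_c(t)` of the square `□_c(t)` (side length `t * w c`). -/
noncomputable def bottomLeft (c : ℝ × ℝ) (w t : ℝ) : ℝ × ℝ := (c.1 - t * w / 2, c.2 - t * w / 2)

/-- The top-right corner `r_c(t)` of the square `□_c(t)` (side length `t * w c`). -/
noncomputable def topRight (c : ℝ × ℝ) (w t : ℝ) : ℝ × ℝ := (c.1 + t * w / 2, c.2 + t * w / 2)

/-- Let `q` have weight `w q > 0` and let `P` be a nonempty finite set of points with positive
weights, each strictly dominating `q`, with `p_x − p_y ≠ q_x − q_y` for all `p ∈ P`, and with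
pairwise distinct `x`- and `y`-coordinates among `P ∪ {q}`.  For `p ∈ P` let
`t_p = 2·max(p_x − q_x, p_y − q_y)/(w p + w q)` be the first time `□_p` intersects `□_q`, and
let `t* = min_{p ∈ P} t_p`.  Then for any `p ∈ P` with `t_p = t*`:
`p ∈ D⁻(q) = {p ∈ P : p_x − p_y < q_x − q_y}` if and only if `(r_q(t*))_y = (ℓ_p(t*))_y` and
`(ℓ_p(t*))_y ≤ (ℓ_{p'}(t*))_y` for all `p' ∈ D⁻(q)`. -/
theorem first_intersection_from_Dminus (q : ℝ × ℝ) (w : ℝ × ℝ → ℝ) (P : Finset (ℝ × ℝ))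
    (hP : P.Nonempty)
    (hwq : 0 < w q) (hwP : ∀ p ∈ P, 0 < w p)
    (hdom : ∀ p ∈ P, q.1 < p.1 ∧ q.2 < p.2)
    (hγ : ∀ p ∈ P, p.1 - p.2 ≠ q.1 - q.2)
    (hdistx : ∀ a ∈ insert q P, ∀ b ∈ insert q P, a ≠ b → a.1 ≠ b.1)
    (hdisty : ∀ a ∈ insert q P, ∀ b ∈ insert q P, a ≠ b → a.2 ≠ b.2)
    (tp : ℝ × ℝ → ℝ)
    (htp : ∀ p, tp p = 2 * max (p.1 - q.1) (p.2 - q.2) / (w p + w q))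
    (tstar : ℝ) (htstar : tstar = P.inf' hP tp) :
    ∀ p ∈ P, tp p = tstar →
      (p.1 - p.2 < q.1 - q.2 ↔
        ((topRight q (w q) tstar).2 = (bottomLeft p (w p) tstar).2 ∧
          ∀ p' ∈ P, p'.1 - p'.2 < q.1 - q.2 →
            (bottomLeft p (w p) tstar).2 ≤ (bottomLeft p' (w p') tstar).2)) := by
  intro p hp hpt
  have key : ∀ a ∈ P, tp a * (w a + w q) = 2 * max (a.1 - q.1) (a.2 - q.2) := fun a ha => by
    rw [htp a, div_mul_cancel₀ _ (add_pos (hwP a ha) hwq).ne']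
  have hkey := key p hp
  rw [hpt] at hkey
  simp only [topRight, bottomLeft]
  constructor
  · intro h
    rw [max_eq_right (by linarith)] at hkey
    refine ⟨by linarith, fun a ha hlt => ?_⟩
    have hle : tstar ≤ tp a := htstar ▸ Finset.inf'_le tp ha
    have hmul := mul_le_mul_of_nonneg_right hle (add_pos (hwP a ha) hwq).le
    rw [key a ha, max_eq_right (by linarith)] at hmul
    linarith
  · rintro ⟨h, -⟩
    have hmax := le_max_left (p.1 - q.1) (p.2 - q.2)
    exact lt_of_le_of_ne (by linarith) (hγ p hp)
end

section
/- Let q ∈ ℝ² have weight w_q > 0 and let P be a nonempty finite set of weighted points, each with positive weight, such that every p ∈ P strictly dominates q (q_x < p_x and q_y < p_y), p_x − p_y ≠ q_x − q_y for all p ∈ P, and all points of P ∪ {q} have pairwise distinct x-coordinates and pairwise distinct y-coordinates. Let D⁺(q) = {p ∈ P : p_x − p_y > q_x − q_y}. For p ∈ P let t_p = 2·max(p_x − q_x, p_y − q_y)/(w_p + w_q) be the first time □_p intersects □_q, and let t* = min_{p ∈ P} t_p. Then for any p ∈ P with t_p = t*: p ∈ D⁺(q) if and only if (r_q(t*))_x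 = (ℓ_p(t*))_x and (ℓ_p(t*))_x ≤ (ℓ_{p'}(t*))_x for all p' ∈ D⁺(q). -/
/-- Let `q` have weight `w q > 0` and let `P` be a nonempty finite set of points with positive
weights, each strictly dominating `q`, with `p_x − p_y ≠ q_x − q_y` for all `p ∈ P`, and with
pairwise distinct `x`- and `y`-coordinates among `P ∪ {q}`.  For `p ∈ P` let
`t_p = 2·max(p_x − q_x, p_y − q_y)/(w p + w q)` be the first time `□_p` intersects `□_q`, and
let `t* = min_{p ∈ P} t_p`.  Then for any `p ∈ P` with `t_p = t*`:
`p ∈ D⁺(q) = {p ∈ P : p_x − p_y > q_x − q_y}` if and only if `(r_q(t*))_x = (ℓ_p(t*))_x` and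
`(ℓ_p(t*))_x ≤ (ℓ_{p'}(t*))_x` for all `p' ∈ D⁺(q)`. -/
theorem first_intersection_from_Dplus (q : ℝ × ℝ) (w : ℝ × ℝ → ℝ) (P : Finset (ℝ × ℝ))
    (hP : P.Nonempty)
    (hwq : 0 < w q) (hwP : ∀ p ∈ P, 0 < w p)
    (hdom : ∀ p ∈ P, q.1 < p.1 ∧ q.2 < p.2)
    (hγ : ∀ p ∈ P, p.1 - p.2 ≠ q.1 - q.2)
    (hdistx : ∀ a ∈ insert q P, ∀ b ∈ insert q P, a ≠ b → a.1 ≠ b.1)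
    (hdisty : ∀ a ∈ insert q P, ∀ b ∈ insert q P, a ≠ b → a.2 ≠ b.2)
    (tp : ℝ × ℝ → ℝ)
    (htp : ∀ p, tp p = 2 * max (p.1 - q.1) (p.2 - q.2) / (w p + w q))
    (tstar : ℝ) (htstar : tstar = P.inf' hP tp) :
    ∀ p ∈ P, tp p = tstar →
      (q.1 - q.2 < p.1 - p.2 ↔
        ((topRight q (w q) tstar).1 = (bottomLeft p (w p) tstar).1 ∧
          ∀ p' ∈ P, q.1 - q.2 < p'.1 - p'.2 →
            (bottomLeft p (w p) tstar).1 ≤ (bottomLeft p' (w p') tstar).1)) := by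
  intro p hp hpt
  have hmin : ∀ a ∈ P, tstar * (w a + w q) ≤ 2 * max (a.1 - q.1) (a.2 - q.2) := by
    intro a ha
    have hle : tstar ≤ tp a := htstar ▸ Finset.inf'_le tp ha
    rwa [htp, le_div_iff₀ (add_pos (hwP a ha) hwq)] at hle
  have heq : tstar * (w p + w q) = 2 * max (p.1 - q.1) (p.2 - q.2) := by
    rw [← hpt, htp, div_mul_cancel₀ _ (add_pos (hwP p hp) hwq).ne']
  simp only [topRight, bottomLeft]
  constructor
  · intro hD
    rw [max_eq_left (by linarith)] at heq
    refine ⟨by linarith, fun a ha haD => ?_⟩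
    have hle := hmin a ha
    rw [max_eq_left (by linarith)] at hle
    linarith
  · rintro ⟨hx, -⟩
    have hmax := le_max_right (p.1 - q.1) (p.2 - q.2)
    exact lt_of_le_of_ne (by linarith) (hγ p hp).symm
end
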